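/- arXiv:1411.1992 — 8 statements merged into one kernel-verified Lean document; each statement's English description precedes it below -/
import Mathlib

section
/- For every real number s with 0 < s ≤ 1 and every natural number N, one has Σ_{k=1}^{N+1} max(k/s, N) ≥ ((s² + 1)/(2s)) · N · (N + 1). -/
/-- Bound `max k t` below by `t` for `k ≤ m` and by `k` for `m < k ≤ n`. -/
theorem le_sum_Icc_max (t : ℝ) {m n : ℕ} (hmn : m ≤ n) :
    m * t + ((n : ℝ) * (n + 1) - m * (m + 1)) / 2 ≤
      ∑ k ∈ Finset.Icc 1 n, max (k : ℝ) t := by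
  induction n, hmn using Nat.le_induction with
  | base =>
    have h := Finset.card_nsmul_le_sum (Finset.Icc 1 m) (fun k : ℕ => max (k : ℝ) t) t
      fun k _ => le_max_right _ _
    simpa using h
  | succ n _ ih =>
    rw [Finset.sum_Icc_succ_top (by omega)]
    have h := le_max_left ((n + 1 : ℕ) : ℝ) t
    push_cast at h ⊢
    linarith

/-- For every real `0 < s ≤ 1` and every `N : ℕ`,
`Σ_{k=1}^{N+1} max(k/s, N) ≥ ((s² + 1)/(2s)) · N · (N + 1)`. -/
theorem key_sum_estimate (s : ℝ) (hs0 : 0 < s) (hs1 : s ≤ 1) (N : ℕ) :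
    ((s ^ 2 + 1) / (2 * s)) * N * (N + 1) ≤
      ∑ k ∈ Finset.Icc 1 (N + 1), max ((k : ℝ) / s) (N : ℝ) := by
  have hN : (0 : ℝ) ≤ N := N.cast_nonneg
  have ht0 : 0 ≤ s * N := by positivity
  have htN : s * N ≤ N := mul_le_of_le_one_left hN hs1
  have hscale : ∑ k ∈ Finset.Icc 1 (N + 1), max ((k : ℝ) / s) (N : ℝ) =
      (∑ k ∈ Finset.Icc 1 (N + 1), max (k : ℝ) (s * N)) / s := by
    rw [Finset.sum_div]
    refine Finset.sum_congr rfl fun k _ => ?_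
    rw [← max_div_div_right hs0.le, mul_div_cancel_left₀ _ hs0.ne']
  have hfl := Nat.floor_le ht0
  have hlt := Nat.lt_floor_add_one (s * N)
  have hmN : ⌊s * N⌋₊ ≤ N + 1 := by
    have : (⌊s * N⌋₊ : ℝ) ≤ N := hfl.trans htN
    exact (Nat.cast_le.mp this).trans N.le_succ
  have hsum := le_sum_Icc_max (s * N) hmN
  rw [hscale, le_div_iff₀ hs0]
  refine le_trans ?_ hsum
  have hlhs : (s ^ 2 + 1) / (2 * s) * N * (N + 1) * s = (s ^ 2 + 1) * N * (N + 1) / 2 := by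
    field_simp
  rw [hlhs]
  generalize (⌊s * N⌋₊ : ℝ) = m at *
  have hsq : (s * N - m) ^ 2 ≤ 1 := by
    rw [sq_le_one_iff₀ (by linarith)]
    linarith
  have hst : s * (s * N) ≤ N := (mul_le_of_le_one_left ht0 hs1).trans htN
  push_cast
  nlinarith
end

section
/- Let G = (V,E) be an infinite, simple, locally finite, connected graph and let s be a real number with 0 < s ≤ 1 such that η(k) ≤ s·k for all k ∈ ℕ. Then for every nonempty finite subset U ⊆ V one has #∂U ≥ (1 − 2s/(1+s²)) · vol(U). In particular, the isoperimetric constant α = inf over finite nonempty U of #∂U/vol(U) satisfies α ≥ 1 − 2s/(1+s²). -/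
/-- If every sublevel set `{d ≤ k}` has at most `s * k` elements, the sum of `max (d v) N` over a
finite set of size `m` is at least the integral of `max (t / s) N` over `[0, m]`. -/
theorem le_sum_max_of_ncard_le {V : Type*} (d : V → ℕ) (s N : ℝ) (hs0 : 0 < s)
    (hN : 0 ≤ N) (hfin : ∀ k : ℕ, {v : V | d v ≤ k}.Finite)
    (hcard : ∀ k : ℕ, ({v : V | d v ≤ k}.ncard : ℝ) ≤ s * k) (m : ℕ) (U : Finset V)
    (hU : U.card = m) :
    m * N + (max (m - s * N) 0) ^ 2 / (2 * s) ≤ ∑ v ∈ U, max (d v : ℝ) N := by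
  classical
  induction m generalizing U with
  | zero =>
    obtain rfl := Finset.card_eq_zero.mp hU
    rw [max_eq_right (by push_cast; nlinarith)]
    simp
  | succ m ih =>
    obtain ⟨v, hv, hmax⟩ := U.exists_max_image d (Finset.card_pos.mp (by omega))
    have hle : ((m + 1 : ℕ) : ℝ) ≤ s * d v := by
      refine le_trans ?_ (hcard (d v))
      rw [← hU, ← Set.ncard_coe_finset]
      exact_mod_cast Set.ncard_le_ncard (fun w hw => hmax w hw) (hfin _)
    have hrec := ih (U.erase v) (by rw [Finset.card_erase_of_mem hv, hU]; rfl)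
    rw [← Finset.add_sum_erase _ _ hv]
    push_cast at hle ⊢
    have hstep : N + ((max (m + 1 - s * N) 0) ^ 2 - (max (m - s * N) 0) ^ 2) / (2 * s)
        ≤ max (d v : ℝ) N := by
      rcases le_total ((m : ℝ) + 1 - s * N) 0 with h | h
      · rw [max_eq_right h, max_eq_right (by linarith)]
        simp
      · refine le_trans ?_ (le_max_left _ _)
        have key : (max (m + 1 - s * N) 0) ^ 2 - (max (m - s * N) 0) ^ 2
            ≤ 2 * (m + 1 - s * N) := by
          rw [max_eq_left h]
          rcases le_total ((m : ℝ) - s * N) 0 with h' | h'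
          · rw [max_eq_right h']; nlinarith
          · rw [max_eq_left h']; nlinarith
        have : ((max (m + 1 - s * N) 0) ^ 2 - (max (m - s * N) 0) ^ 2) / (2 * s)
            ≤ d v - N := by
          rw [div_le_iff₀ (by positivity)]; nlinarith
        linarith
    rw [sub_div] at hstep
    linarith

/-- The number of edges leaving `U` is the sum over `U` of the numbers of neighbors outside `U`. -/
theorem ncard_edgeBoundary_eq_sum {V : Type*} [DecidableEq V] (G : SimpleGraph V)
    [∀ v : V, Fintype (G.neighborSet v)] (U : Finset V) :
    {p : V × V | p.1 ∈ U ∧ p.2 ∉ U ∧ G.Adj p.1 p.2}.ncard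
      = ∑ v ∈ U, (G.neighborFinset v \ U).card := by
  rw [← Finset.card_sigma, ← Finset.card_map (Equiv.sigmaEquivProd V V).toEmbedding,
    ← Set.ncard_coe_finset]
  congr 1
  ext ⟨v, w⟩
  simp [and_comm]


/-- If `G` is an infinite, simple, locally finite, connected graph and
`0 < s ≤ 1` satisfies `η(k) ≤ s·k` for all `k`, then every nonempty finite `U ⊆ V`
satisfies `#∂U ≥ (1 − 2s/(1+s²)) · vol(U)` (hence `α ≥ 1 − 2s/(1+s²)`). -/
theorem isoperimetric_bound
    {V : Type*} (G : SimpleGraph V) [Infinite V]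
    [∀ v : V, Fintype (G.neighborSet v)] (hconn : G.Connected)
    (s : ℝ) (hs0 : 0 < s) (hs1 : s ≤ 1)
    (hfin : ∀ k : ℕ, {v : V | G.degree v ≤ k}.Finite)
    (heta : ∀ k : ℕ, ({v : V | G.degree v ≤ k}.ncard : ℝ) ≤ s * k)
    (U : Finset V) (hU : U.Nonempty) :
    (1 - 2 * s / (1 + s ^ 2)) * ∑ v ∈ U, (G.degree v : ℝ) ≤
      ({p : V × V | p.1 ∈ U ∧ p.2 ∉ U ∧ G.Adj p.1 p.2}.ncard : ℝ) := by
  classical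
  have hsum : ∀ v, (G.degree v : ℝ)
      = (G.neighborFinset v ∩ U).card + (G.neighborFinset v \ U).card := by
    intro v
    rw [← G.card_neighborFinset_eq_degree, ← Finset.card_inter_add_card_sdiff _ U]
    push_cast
    rfl
  have hmax := le_sum_max_of_ncard_le (fun v => G.degree v) s U.card hs0 (by positivity)
    hfin heta U.card U rfl
  rw [ncard_edgeBoundary_eq_sum]
  push_cast
  set c : ℝ := 2 * s / (1 + s ^ 2) with hc
  set n : ℝ := (U.card : ℝ) with hn
  have hn0 : 0 ≤ n := by positivity
  have hc0 : 0 ≤ c := by positivity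
  have hc1 : c ≤ 1 := by
    rw [hc, div_le_one (by positivity)]
    nlinarith [sq_nonneg (1 - s)]
  have hvert : ∀ v ∈ U, ((1 - c) * G.degree v : ℝ)
      ≤ (G.neighborFinset v \ U).card + n - c * max (G.degree v : ℝ) n := by
    intro v _
    have h1 := hsum v
    have h2 : ((G.neighborFinset v ∩ U).card : ℝ) ≤ n := by
      rw [hn]
      exact_mod_cast Finset.card_le_card Finset.inter_subset_right
    have h3 : (0 : ℝ) ≤ (G.neighborFinset v \ U).card := by positivity
    rcases le_total (G.degree v : ℝ) n with h | h
    · rw [max_eq_right h]; nlinarith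
    · rw [max_eq_left h]; linarith
  have htot := Finset.sum_le_sum hvert
  rw [← Finset.mul_sum, Finset.sum_sub_distrib, Finset.sum_add_distrib, ← Finset.mul_sum,
    Finset.sum_const, nsmul_eq_mul, ← hn] at htot
  have hnn : n * n = c * (n * n + (max (n - s * n) 0) ^ 2 / (2 * s)) := by
    rw [max_eq_left (by nlinarith), hc]
    field_simp
    ring
  have := mul_le_mul_of_nonneg_left hmax hc0
  linarith
end

section
/- Let G = (V,E) be an infinite, simple, locally finite, connected graph with minimum vertex degree d = min_{v∈V} deg(v), and let s be a real number with 0 < s < 1 such that η(k) ≤ s·k for all k ∈ ℕ. Then for every finitely supported function φ : V → ℝ one has d·(1 − γ(s)) · Σ_{v∈V} φ(v)² ≤ (1/2) · Σ_{(v,w) : v∼w} (φ(v) − φ(w))², where the sum on the right runs over ordered pairs of adjacent vertices. -/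
open Finset in
/-- A layer-cake inequality: a bilinear bound on indicators of finite sets extends to
nonnegative functions. -/
theorem sum_mul_min_le_of_forall_sum_le {V : Type*} (a : V → V → ℝ) (b : V → ℝ)
    (h : ∀ W : Finset V, ∑ v ∈ W, ∑ w ∈ W, a v w ≤ ∑ v ∈ W, b v) (S : Finset V) :
    ∀ ψ : V → ℝ, (∀ v ∈ S, 0 ≤ ψ v) →
      ∑ v ∈ S, ∑ w ∈ S, a v w * min (ψ v) (ψ w) ≤ ∑ v ∈ S, b v * ψ v := by
  classical
  induction S using Finset.strongInduction with
  | H S ih =>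
    intro ψ hψ
    rcases S.eq_empty_or_nonempty with rfl | hS
    · simp
    obtain ⟨u, hu, hmin⟩ := S.exists_min_image ψ hS
    have hrec := ih (S.erase u) (erase_ssubset hu) (fun v => ψ v - ψ u)
      (fun v hv => sub_nonneg.2 (hmin v (mem_of_mem_erase hv)))
    have hright : ∑ v ∈ S.erase u, b v * (ψ v - ψ u) = ∑ v ∈ S, b v * (ψ v - ψ u) :=
      sum_erase _ (by simp)
    have hleft : ∑ v ∈ S.erase u, ∑ w ∈ S.erase u, a v w * min (ψ v - ψ u) (ψ w - ψ u)
        = ∑ v ∈ S, ∑ w ∈ S, a v w * min (ψ v - ψ u) (ψ w - ψ u) := by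
      rw [← sum_erase (a := u) S]
      · refine sum_congr rfl fun v hv => sum_erase _ ?_
        rw [sub_self, min_eq_right (sub_nonneg.2 (hmin v (mem_of_mem_erase hv))), mul_zero]
      · refine sum_eq_zero fun w hw => ?_
        rw [sub_self, min_eq_left (sub_nonneg.2 (hmin w hw)), mul_zero]
    rw [hleft, hright] at hrec
    simp only [min_sub_sub_right, mul_sub, sum_sub_distrib, ← sum_mul] at hrec
    linarith [mul_le_mul_of_nonneg_right (h S) (hψ u hu)]

/-- If at most `s * k` points of `W` have value at most `k`, then the values `f v` dominate the
sequence `i / s`, which bounds the sum of their truncations from below. -/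
theorem le_sum_max_of_card_filter_le {V : Type*} (f : V → ℕ) {s : ℝ} (hs : 0 < s) {m : ℝ}
    (hm : 0 ≤ m) (W : Finset V) (h : ∀ k : ℕ, ((W.filter fun v => f v ≤ k).card : ℝ) ≤ s * k) :
    m * W.card + max (W.card - s * m) 0 ^ 2 / (2 * s) ≤
      ∑ v ∈ W, max (f v : ℝ) m := by
  classical
  induction W using Finset.strongInduction with
  | H W ih =>
    rcases W.eq_empty_or_nonempty with rfl | hW
    · simp [max_eq_right (neg_nonpos.2 (mul_nonneg hs.le hm))]
    obtain ⟨u, hu, hmax⟩ := W.exists_max_image f hW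
    have hrec := ih (W.erase u) (Finset.erase_ssubset hu) fun k =>
      (Nat.cast_le.2 (Finset.card_le_card
        (Finset.filter_subset_filter _ (Finset.erase_subset u W)))).trans (h k)
    have hcard : ((W.erase u).card : ℝ) + 1 = W.card := by
      exact_mod_cast Finset.card_erase_add_one hu
    have hfu : (W.card : ℝ) ≤ s * f u := by
      have := h (f u)
      rwa [Finset.filter_true_of_mem hmax] at this
    rw [← Finset.add_sum_erase W _ hu, ← hcard]
    rw [← hcard] at hfu
    generalize ((W.erase u).card : ℝ) = j at *
    suffices hstep : m + max (j + 1 - s * m) 0 ^ 2 / (2 * s) ≤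
        max (f u : ℝ) m + max (j - s * m) 0 ^ 2 / (2 * s) by linarith
    rcases le_total (j + 1 - s * m) 0 with hj | hj
    · rw [max_eq_right hj, max_eq_right (by linarith : j - s * m ≤ 0)]
      linarith [le_max_right (f u : ℝ) m]
    · have hsq : max (j + 1 - s * m) 0 ^ 2 ≤
          2 * (j + 1 - s * m) + max (j - s * m) 0 ^ 2 := by
        rw [max_eq_left hj]
        rcases le_total (j - s * m) 0 with hj' | hj'
        · rw [max_eq_right hj']
          nlinarith
        · rw [max_eq_left hj']
          nlinarith
      have hdiv : max (j + 1 - s * m) 0 ^ 2 / (2 * s) ≤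
          (f u - m) + max (j - s * m) 0 ^ 2 / (2 * s) := by
        rw [div_le_iff₀ (by positivity), add_mul, div_mul_cancel₀ _ (by positivity)]
        nlinarith
      linarith [le_max_left (f u : ℝ) m]

open Finset in
/-- An isoperimetric inequality for graphs with few vertices of small degree. -/
theorem SimpleGraph.sum_adj_le_mul_sum_degree {V : Type*} (G : SimpleGraph V)
    [∀ v : V, Fintype (G.neighborSet v)] [DecidableRel G.Adj] {s : ℝ} (hs0 : 0 < s) (hs1 : s < 1)
    (hfin : ∀ k : ℕ, {v : V | G.degree v ≤ k}.Finite)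
    (heta : ∀ k : ℕ, ({v : V | G.degree v ≤ k}.ncard : ℝ) ≤ s * k) (W : Finset V) :
    ∑ v ∈ W, ∑ w ∈ W, (if G.Adj v w then (1 : ℝ) else 0) ≤
      ∑ v ∈ W, 2 * s / (1 + s ^ 2) * G.degree v := by
  classical
  have hcount : ∀ k : ℕ, ((W.filter fun v => G.degree v ≤ k).card : ℝ) ≤ s * k := fun k => by
    refine le_trans ?_ (heta k)
    rw [← Set.ncard_coe_finset]
    exact_mod_cast Set.ncard_le_ncard (fun v hv => (mem_filter.1 hv).2) (hfin k)
  have hn : (0 : ℝ) ≤ W.card := Nat.cast_nonneg _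
  have hmax := le_sum_max_of_card_filter_le (fun v => G.degree v) hs0 hn W hcount
  rw [max_eq_left (by nlinarith : (0 : ℝ) ≤ W.card - s * W.card)] at hmax
  have hc1 : 2 * s / (1 + s ^ 2) ≤ 1 := by
    rw [div_le_one (by positivity)]
    nlinarith [sq_nonneg (1 - s)]
  have hc0 : 0 ≤ 2 * s / (1 + s ^ 2) := by positivity
  have hpoint : ∀ v ∈ W, (∑ w ∈ W, (if G.Adj v w then (1 : ℝ) else 0)) ≤
      2 * s / (1 + s ^ 2) * G.degree v +
        (W.card - 2 * s / (1 + s ^ 2) * max (G.degree v : ℝ) W.card) := fun v _ => by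
    rw [sum_boole]
    have h1 : ((W.filter fun w => G.Adj v w).card : ℝ) ≤ W.card := by
      exact_mod_cast card_filter_le _ _
    have h2 : ((W.filter fun w => G.Adj v w).card : ℝ) ≤ G.degree v := by
      rw [← G.card_neighborFinset_eq_degree]
      exact_mod_cast card_le_card fun w hw => by simpa using (mem_filter.1 hw).2
    rcases le_total (G.degree v : ℝ) W.card with h | h
    · rw [max_eq_right h]
      nlinarith
    · rw [max_eq_left h]
      linarith
  refine (sum_le_sum hpoint).trans ?_
  rw [sum_add_distrib, sum_sub_distrib, sum_const, nsmul_eq_mul, ← mul_sum W (fun v => max _ _)]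
  have hkey : (W.card : ℝ) * W.card ≤
      2 * s / (1 + s ^ 2) * ∑ v ∈ W, max (G.degree v : ℝ) W.card := by
    refine le_trans (le_of_eq ?_) (mul_le_mul_of_nonneg_left
      hmax hc0)
    field_simp
    ring
  linarith

open Finset in
/-- Cheeger's inequality for the quadratic form of the Laplacian, on a finite set `T` containing
the support `S` of `φ` together with its neighbours. -/
theorem SimpleGraph.mul_sum_degree_le_of_sum_adj_le {V : Type*} (G : SimpleGraph V)
    [∀ v : V, Fintype (G.neighborSet v)] [DecidableRel G.Adj] {c : ℝ} (hc : c ≤ 1)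
    (hG : ∀ W : Finset V, ∑ v ∈ W, ∑ w ∈ W, (if G.Adj v w then (1 : ℝ) else 0) ≤
      ∑ v ∈ W, c * G.degree v)
    {S T : Finset V} (hST : S ⊆ T) (hT : ∀ v ∈ S, ∀ w, G.Adj v w → w ∈ T)
    {φ : V → ℝ} (hφ : ∀ v ∉ S, φ v = 0) :
    (1 - √(1 - (1 - c) ^ 2)) * ∑ v ∈ S, G.degree v * φ v ^ 2 ≤
      1 / 2 * ∑ p ∈ (T ×ˢ T).filter (fun p => G.Adj p.1 p.2), (φ p.1 - φ p.2) ^ 2 := by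
  classical
  set P := (T ×ˢ T).filter (fun p : V × V => G.Adj p.1 p.2) with hP
  set D := ∑ v ∈ S, G.degree v * φ v ^ 2 with hD
  set Q := ∑ p ∈ P, (φ p.1 - φ p.2) ^ 2 with hQ
  set R := ∑ p ∈ P, (φ p.1 + φ p.2) ^ 2 with hR
  have hD0 : 0 ≤ D := sum_nonneg fun v _ => by positivity
  have hfst : ∑ p ∈ P, φ p.1 ^ 2 = D := by
    rw [hP, sum_filter, sum_product, hD, ← sum_subset hST]
    · refine sum_congr rfl fun v hv => ?_
      dsimp only
      rw [← sum_filter, sum_const, nsmul_eq_mul, ← G.card_neighborFinset_eq_degree]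
      congr 3
      ext w
      simpa using hT v hv w
    · intro v _ hv
      simp [hφ v hv]
  have hsnd : ∑ p ∈ P, φ p.2 ^ 2 = D := by
    rw [← hfst]
    refine sum_nbij' Prod.swap Prod.swap ?_ ?_ ?_ ?_ ?_ <;>
      simp +contextual [hP, G.adj_comm]
  have hsum : Q + R = 4 * D := by
    have : Q + R = 2 * (∑ p ∈ P, φ p.1 ^ 2) + 2 * ∑ p ∈ P, φ p.2 ^ 2 := by
      rw [hQ, hR, ← sum_add_distrib, mul_sum, mul_sum, ← sum_add_distrib]
      exact sum_congr rfl fun p _ => by ring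
    rw [this, hfst, hsnd]
    ring
  have hmin : ∑ p ∈ P, min (φ p.1 ^ 2) (φ p.2 ^ 2) ≤ c * D := by
    have hlayer := sum_mul_min_le_of_forall_sum_le
      (fun v w => if G.Adj v w then (1 : ℝ) else 0) (fun v => c * G.degree v) hG S
      (fun v => φ v ^ 2) fun v _ => sq_nonneg _
    refine le_trans (le_of_eq ?_) (hlayer.trans (le_of_eq ?_))
    · rw [hP, sum_filter, sum_product, ← sum_subset hST]
      · refine sum_congr rfl fun v _ => ?_
        rw [← sum_subset hST]
        · exact sum_congr rfl fun w _ => by simp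
        · intro w _ hw
          simp [hφ w hw, sq_nonneg]
      · intro v _ hv
        simp [hφ v hv, sq_nonneg]
    · rw [hD, mul_sum]
      exact sum_congr rfl fun v _ => by ring
  have habs : ∑ p ∈ P, |φ p.1 - φ p.2| * |φ p.1 + φ p.2| =
      2 * D - 2 * ∑ p ∈ P, min (φ p.1 ^ 2) (φ p.2 ^ 2) := by
    have : 2 * D = ∑ p ∈ P, (φ p.1 ^ 2 + φ p.2 ^ 2) := by
      rw [sum_add_distrib, hfst, hsnd, two_mul]
    rw [this, mul_sum, ← sum_sub_distrib]
    refine sum_congr rfl fun p _ => ?_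
    rw [← abs_mul, show (φ p.1 - φ p.2) * (φ p.1 + φ p.2) = φ p.1 ^ 2 - φ p.2 ^ 2 by ring]
    rcases le_total (φ p.1 ^ 2) (φ p.2 ^ 2) with h | h
    · rw [min_eq_left h, abs_of_nonpos (by linarith)]
      ring
    · rw [min_eq_right h, abs_of_nonneg (by linarith)]
      ring
  have hcs : (∑ p ∈ P, |φ p.1 - φ p.2| * |φ p.1 + φ p.2|) ^ 2 ≤ Q * R := by
    have := sum_mul_sq_le_sq_mul_sq P (fun p => |φ p.1 - φ p.2|) (fun p => |φ p.1 + φ p.2|)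
    simpa only [sq_abs] using this
  have hlow : (2 * ((1 - c) * D)) ^ 2 ≤ Q * R := by
    refine le_trans (pow_le_pow_left₀ ?_ ?_ 2) hcs
    · have := mul_nonneg (sub_nonneg.2 hc) hD0
      linarith
    · rw [habs]
      linarith
  have hsq : (D - 1 / 2 * Q) ^ 2 ≤ (1 - (1 - c) ^ 2) * D ^ 2 := by
    rw [show R = 4 * D - Q by linarith] at hlow
    nlinarith
  have hroot := Real.le_sqrt_of_sq_le hsq
  rw [Real.sqrt_mul' _ (sq_nonneg D), Real.sqrt_sq hD0] at hroot
  linarith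

/-- Let `G` be an infinite, simple, locally finite, connected graph with
minimum vertex degree `d`, and let `0 < s < 1` satisfy `η(k) ≤ s·k` for all `k`.  Then for
every finitely supported `φ : V → ℝ`,
`d·(1 − γ(s)) · Σ_v φ(v)² ≤ (1/2) · Σ_{(v,w) : v∼w} (φ(v) − φ(w))²`
where `γ(s) = √(1 − (1−s)⁴/(1+s²)²)`. -/
theorem spectral_gap_quadratic_form
    {V : Type*} (G : SimpleGraph V) [Infinite V]
    [∀ v : V, Fintype (G.neighborSet v)] (hconn : G.Connected)
    (d : ℕ) (hd : IsLeast {n : ℕ | ∃ v : V, G.degree v = n} d)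
    (s : ℝ) (hs0 : 0 < s) (hs1 : s < 1)
    (hfin : ∀ k : ℕ, {v : V | G.degree v ≤ k}.Finite)
    (heta : ∀ k : ℕ, ({v : V | G.degree v ≤ k}.ncard : ℝ) ≤ s * k)
    (φ : V → ℝ) (hφ : (Function.support φ).Finite) :
    (d : ℝ) * (1 - Real.sqrt (1 - (1 - s) ^ 4 / (1 + s ^ 2) ^ 2)) * ∑ᶠ v : V, φ v ^ 2 ≤
      (1 / 2) * ∑ᶠ p ∈ {p : V × V | G.Adj p.1 p.2}, (φ p.1 - φ p.2) ^ 2 := by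
  classical
  set S := hφ.toFinset with hS
  set T := S ∪ S.biUnion fun v => G.neighborFinset v with hT
  have hφS : ∀ v ∉ S, φ v = 0 := fun v hv => by simpa [hS] using hv
  have hnbr : ∀ v ∈ S, ∀ w, G.Adj v w → w ∈ T := fun v hv w hvw =>
    Finset.mem_union_right _ (Finset.mem_biUnion.2 ⟨v, hv, by simpa using hvw⟩)
  have hST : S ⊆ T := Finset.subset_union_left
  have hc1 : 2 * s / (1 + s ^ 2) ≤ 1 := by
    rw [div_le_one (by positivity)]
    nlinarith [sq_nonneg (1 - s)]
  have hcheeger := G.mul_sum_degree_le_of_sum_adj_le hc1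
    (G.sum_adj_le_mul_sum_degree hs0 hs1 hfin heta) hST hnbr hφS
  have halpha : (1 - 2 * s / (1 + s ^ 2)) ^ 2 = (1 - s) ^ 4 / (1 + s ^ 2) ^ 2 := by
    field_simp
    ring
  rw [halpha] at hcheeger
  have hleft : ∑ᶠ v : V, φ v ^ 2 = ∑ v ∈ S, φ v ^ 2 :=
    finsum_eq_sum_of_support_subset _ fun v hv => by
      simpa [hS] using hv
  have hright : ∑ᶠ p ∈ {p : V × V | G.Adj p.1 p.2}, (φ p.1 - φ p.2) ^ 2 =
      ∑ p ∈ (T ×ˢ T).filter (fun p => G.Adj p.1 p.2), (φ p.1 - φ p.2) ^ 2 := by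
    refine finsum_mem_eq_sum_of_inter_support_eq _ ?_
    ext p
    simp only [Set.mem_inter_iff, Set.mem_ofPred_eq, Finset.coe_filter, Finset.mem_product,
      Function.mem_support]
    refine ⟨fun ⟨hadj, hne⟩ => ⟨⟨?_, hadj⟩, hne⟩, fun ⟨⟨_, hadj⟩, hne⟩ => ⟨hadj, hne⟩⟩
    by_cases h1 : p.1 ∈ S
    · exact ⟨hST h1, hnbr _ h1 _ hadj⟩
    by_cases h2 : p.2 ∈ S
    · exact ⟨hnbr _ h2 _ hadj.symm, hST h2⟩
    exact absurd (by simp [hφS _ h1, hφS _ h2]) hne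
  have hdeg : (d : ℝ) * ∑ v ∈ S, φ v ^ 2 ≤ ∑ v ∈ S, G.degree v * φ v ^ 2 := by
    rw [Finset.mul_sum]
    gcongr with v
    exact hd.2 ⟨v, rfl⟩
  have hgamma : 0 ≤ 1 - √(1 - (1 - s) ^ 4 / (1 + s ^ 2) ^ 2) := by
    have : 0 ≤ (1 - s) ^ 4 / (1 + s ^ 2) ^ 2 := by positivity
    rw [sub_nonneg, Real.sqrt_le_one]
    linarith
  rw [hleft, hright]
  refine le_trans ?_ hcheeger
  calc _ = (1 - √(1 - (1 - s) ^ 4 / (1 + s ^ 2) ^ 2)) * (d * ∑ v ∈ S, φ v ^ 2) := by ring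
    _ ≤ _ := mul_le_mul_of_nonneg_left hdeg hgamma
end

section
/- Let G = (V,E) be an infinite, simple, locally finite, connected graph, let (v_k)_{k≥0} be an enumeration of V with deg(v_k) ≤ deg(v_{k+1}) for all k, let s > 0, and let n ∈ ℕ be such that deg(v_k) ≥ (k+1)/s for all k ≥ n. Then every finite subset W ⊆ V with #W ≥ 2n satisfies vol(W) ≥ (3/(8s)) · (#W)². -/
/-- Among finite sets of naturals of a given size, the initial segment minimises the sum of a
monotone function. -/
theorem Monotone.sum_range_card_le {f : ℕ → ℝ} (hf : Monotone f) (S : Finset ℕ) :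
    ∑ k ∈ Finset.range S.card, f k ≤ ∑ k ∈ S, f k := by
  induction S using Finset.induction_on_max with
  | empty => simp
  | insert a S ha ih =>
    have haS : a ∉ S := fun h => (ha a h).false
    have hcard : S.card ≤ a := by
      simpa using Finset.card_le_card (fun x hx => Finset.mem_range.2 (ha x hx) :
        S ⊆ Finset.range a)
    rw [Finset.card_insert_of_notMem haS, Finset.sum_range_succ, Finset.sum_insert haS, add_comm]
    exact add_le_add (hf hcard) ih

theorem sum_range_add_succ (n d : ℕ) :
    ∑ k ∈ Finset.range (n + d), (if n ≤ k then (k : ℝ) + 1 else 0) =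
      ((n + d : ℝ) * (n + d + 1) - n * (n + 1)) / 2 := by
  induction d with
  | zero =>
    rw [add_zero, Finset.sum_eq_zero]
    · simp
    · intro k hk
      rw [if_neg (by simpa using hk)]
  | succ d ih =>
    rw [← add_assoc, Finset.sum_range_succ, ih, if_pos (by omega)]
    push_cast
    ring

/-- Let `G` be an infinite, simple, locally finite, connected graph,
`e` an enumeration with nondecreasing degrees, `s > 0` and `n` such that
`deg (e k) ≥ (k+1)/s` for all `k ≥ n`.  Then every finite `W ⊆ V` with `#W ≥ 2n`
satisfies `vol(W) ≥ (3/(8s)) · (#W)²`. -/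
theorem volume_quadratic_lower_bound
    {V : Type*} (G : SimpleGraph V) [Infinite V]
    [∀ v : V, Fintype (G.neighborSet v)] (hconn : G.Connected)
    (e : ℕ → V) (he : Function.Bijective e)
    (hmono : ∀ k : ℕ, G.degree (e k) ≤ G.degree (e (k + 1)))
    (s : ℝ) (hs : 0 < s) (n : ℕ)
    (hdeg : ∀ k ≥ n, ((k : ℝ) + 1) / s ≤ (G.degree (e k) : ℝ))
    (W : Finset V) (hW : 2 * n ≤ W.card) :
    (3 / (8 * s)) * (W.card : ℝ) ^ 2 ≤ ∑ w ∈ W, (G.degree w : ℝ) := by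
  obtain ⟨S, rfl⟩ : ∃ S : Finset ℕ, W = S.map ⟨e, he.injective⟩ := by
    refine ⟨W.preimage e he.injective.injOn, ?_⟩
    ext w
    obtain ⟨k, rfl⟩ := he.surjective w
    simp
  rw [Finset.card_map] at hW ⊢
  rw [Finset.sum_map]
  have hmon : Monotone fun k : ℕ => if n ≤ k then (k : ℝ) + 1 else 0 := by
    intro a b hab
    have hab' : (a : ℝ) ≤ b := by exact_mod_cast hab
    dsimp only
    split_ifs
    · linarith
    · omega
    · positivity
    · exact le_rfl
  obtain ⟨d, hd⟩ : ∃ d, S.card = n + d := ⟨S.card - n, by omega⟩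
  have hnd : (n : ℝ) ≤ d := by exact_mod_cast (by omega : n ≤ d)
  calc (3 / (8 * s)) * (S.card : ℝ) ^ 2
      = (3 / 8 * (S.card : ℝ) ^ 2) / s := by field_simp
    _ ≤ (∑ k ∈ Finset.range S.card, (if n ≤ k then (k : ℝ) + 1 else 0)) / s := by
        gcongr
        rw [hd, sum_range_add_succ]
        push_cast
        nlinarith [(Nat.cast_nonneg n : (0 : ℝ) ≤ n)]
    _ ≤ (∑ k ∈ S, (if n ≤ k then (k : ℝ) + 1 else 0)) / s := by
        exact div_le_div_of_nonneg_right (hmon.sum_range_card_le S) hs.le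
    _ ≤ ∑ k ∈ S, (G.degree (e k) : ℝ) := by
        rw [Finset.sum_div]
        refine Finset.sum_le_sum fun k _ => ?_
        split_ifs with h
        · exact hdeg k h
        · simp
end

section
/- Let G = (V,E) be an infinite, simple, locally finite, connected graph, let (v_k)_{k≥0} be an enumeration of V with deg(v_k) ≤ deg(v_{k+1}) for all k, let s ∈ (0,1), and let n ∈ ℕ be such that deg(v_k) ≥ (k+1)/s for all k ≥ n. Then for every vertex v ∈ V and every integer k ≥ 2 with #B_k(v) ≥ n + 1, one has #B_{k+1}(v) ≥ s⁻¹ · #B_k(v) + #B_{k−2}(v). -/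
/-- In a connected locally finite graph, if a ball is finite, then so is the next larger one. -/
theorem SimpleGraph.Connected.finite_dist_le_succ {V : Type*} {G : SimpleGraph V}
    [∀ v : V, Fintype (G.neighborSet v)] (hconn : G.Connected) {v : V} {k : ℕ}
    (h : {w : V | G.dist v w ≤ k}.Finite) : {w : V | G.dist v w ≤ k + 1}.Finite := by
  refine (h.union (h.biUnion fun w _ => (G.neighborSet w).toFinite)).subset fun w hw => ?_
  obtain ⟨p, hp⟩ := hconn.exists_walk_length_eq_dist w v
  rw [Set.mem_ofPred_eq, SimpleGraph.dist_comm, ← hp] at hw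
  cases p with
  | nil => exact Or.inl (by simp)
  | @cons _ u _ hadj q =>
    refine Or.inr (Set.mem_biUnion (x := u) ?_ hadj.symm)
    rw [Set.mem_ofPred_eq, SimpleGraph.dist_comm]
    rw [SimpleGraph.Walk.length_cons] at hw
    exact (SimpleGraph.dist_le q).trans (by lia)

/-- A nonempty finite set contains an element whose index in a given enumeration is at least
its cardinality minus one. -/
theorem Set.exists_ncard_le_index_add_one {V : Type*} {e : ℕ → V} (he : Function.Surjective e)
    {S : Set V} (hS : 0 < S.ncard) : ∃ m, e m ∈ S ∧ S.ncard ≤ m + 1 := by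
  by_contra! h
  have hsub : S ⊆ e '' Set.Iio (S.ncard - 1) := by
    intro w hw
    obtain ⟨m, rfl⟩ := he w
    have := h m hw
    exact ⟨m, by simp only [Set.mem_Iio]; lia, rfl⟩
  have h₁ := Set.ncard_le_ncard hsub ((Set.finite_Iio _).image e)
  have h₂ := Set.ncard_image_le (f := e) (Set.finite_Iio (S.ncard - 1))
  rw [Set.ncard_Iio_nat] at h₂
  lia


/-- Let `G` be an infinite, simple, locally finite, connected graph,
`e` an enumeration with nondecreasing degrees, `s ∈ (0,1)` and `n` such that
`deg (e k) ≥ (k+1)/s` for all `k ≥ n`.  Then for every vertex `v` and every `k ≥ 2` with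
`#B_k(v) ≥ n + 1` one has `#B_{k+1}(v) ≥ s⁻¹·#B_k(v) + #B_{k−2}(v)`. -/
theorem ball_growth_recursion
    {V : Type*} (G : SimpleGraph V) [Infinite V]
    [∀ v : V, Fintype (G.neighborSet v)] (hconn : G.Connected)
    (e : ℕ → V) (he : Function.Bijective e)
    (hmono : ∀ k : ℕ, G.degree (e k) ≤ G.degree (e (k + 1)))
    (s : ℝ) (hs0 : 0 < s) (hs1 : s < 1) (n : ℕ)
    (hdeg : ∀ k ≥ n, ((k : ℝ) + 1) / s ≤ (G.degree (e k) : ℝ))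
    (v : V) (k : ℕ) (hk : 2 ≤ k)
    (hball : n + 1 ≤ {w : V | G.dist v w ≤ k}.ncard) :
    s⁻¹ * ({w : V | G.dist v w ≤ k}.ncard : ℝ) +
        ({w : V | G.dist v w ≤ k - 2}.ncard : ℝ) ≤
      ({w : V | G.dist v w ≤ k + 1}.ncard : ℝ) := by
  have hfin : {w : V | G.dist v w ≤ k}.Finite := Set.finite_of_ncard_pos (by lia)
  have hfin' := hconn.finite_dist_le_succ hfin
  obtain ⟨m, hm, hcard⟩ := Set.exists_ncard_le_index_add_one he.surjective
    (S := {w : V | G.dist v w ≤ k}) (by lia)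
  rw [Set.mem_ofPred_eq] at hm
  have hdegm : s⁻¹ * ({w : V | G.dist v w ≤ k}.ncard : ℝ) ≤ G.degree (e m) := by
    refine le_trans ?_ (hdeg m (by lia))
    rw [div_eq_inv_mul]
    gcongr
    exact_mod_cast hcard
  have hneighbors : (G.neighborSet (e m)).ncard = G.degree (e m) := by
    rw [Set.ncard_eq_toFinset_card', ← G.card_neighborFinset_eq_degree]
    rfl
  have hdist : k ≤ G.dist v (e m) := by
    by_contra! hlt
    have hsub : G.neighborSet (e m) ⊆ {w : V | G.dist v w ≤ k} := by
      intro w hw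
      have := hconn.dist_triangle (u := v) (v := e m) (w := w)
      rw [SimpleGraph.dist_eq_one_iff_adj.mpr hw] at this
      exact this.trans hlt
    have hle := Set.ncard_le_ncard hsub hfin
    rw [hneighbors] at hle
    have hle' : (G.degree (e m) : ℝ) ≤ ({w : V | G.dist v w ≤ k}.ncard : ℝ) := by
      exact_mod_cast hle
    have hpos : (0 : ℝ) < ({w : V | G.dist v w ≤ k}.ncard : ℝ) := by
      exact_mod_cast (show 0 < {w : V | G.dist v w ≤ k}.ncard by lia)
    have := mul_lt_mul_of_pos_right ((one_lt_inv₀ hs0).mpr hs1) hpos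
    linarith
  have hdisj : Disjoint (G.neighborSet (e m)) {w : V | G.dist v w ≤ k - 2} := by
    refine Set.disjoint_left.mpr fun w hw hwv => ?_
    have := hconn.dist_triangle (u := v) (v := w) (w := e m)
    rw [SimpleGraph.dist_eq_one_iff_adj.mpr hw.symm] at this
    rw [Set.mem_ofPred_eq] at hwv
    lia
  have hsub : G.neighborSet (e m) ∪ {w : V | G.dist v w ≤ k - 2} ⊆
      {w : V | G.dist v w ≤ k + 1} := by
    rintro w (hw | hw)
    · have := hconn.dist_triangle (u := v) (v := e m) (w := w)
      rw [SimpleGraph.dist_eq_one_iff_adj.mpr hw] at this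
      exact this.trans (by lia)
    · rw [Set.mem_ofPred_eq] at hw ⊢
      lia
  have hle := Set.ncard_le_ncard hsub hfin'
  rw [Set.ncard_union_eq hdisj (G.neighborSet (e m)).toFinite
    (hfin'.subset (Set.subset_union_right.trans hsub)), hneighbors] at hle
  refine (add_le_add_left hdegm _).trans ?_
  exact_mod_cast hle
end

section
/- Let G = (V,E) be an infinite, simple, locally finite, connected graph, let (v_k)_{k≥0} be an enumeration of V with deg(v_k) ≤ deg(v_{k+1}) for all k, let s ∈ (0,1), p ∈ (0,1), λ > 0, and let n ∈ ℕ be such that deg(v_k) ≥ (k+1)/s for all k ≥ n. Then for every vertex v ∈ V not contained in K = ⋃_{k=0}^{n−1} B_1(v_k), one has Σ_{w∼v} (deg(w) + λ)^{−p} ≤ (s^p/(1−p)) · ((deg(v) + λ)^{1−p} − (sλ)^{1−p}). -/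
/-- An antitone function summed over a finite set of naturals is at most its sum over the initial
segment of the same size. -/
theorem Finset.sum_le_sum_range_card_of_antitone {f : ℕ → ℝ} (hf : Antitone f) (S : Finset ℕ) :
    ∑ i ∈ S, f i ≤ ∑ i ∈ Finset.range S.card, f i := by
  induction S using Finset.induction_on_max with
  | empty => simp
  | insert a S ha ih =>
    have hnot : a ∉ S := fun h => lt_irrefl a (ha a h)
    have hcard : S.card ≤ a := by
      simpa using Finset.card_le_card (t := Finset.range a) fun x hx =>
        Finset.mem_range.mpr (ha x hx)
    rw [Finset.sum_insert hnot, Finset.card_insert_of_notMem hnot, Finset.sum_range_succ]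
    linarith [hf hcard]

theorem Real.one_sub_mul_rpow_neg_le_sub {p x : ℝ} (hp0 : 0 ≤ p) (hp1 : p ≤ 1) (hx : 0 ≤ x) :
    (1 - p) * (x + 1) ^ (-p) ≤ (x + 1) ^ (1 - p) - x ^ (1 - p) := by
  have hx1 : 0 < x + 1 := by linarith
  have hbern := rpow_one_add_le_one_add_mul_self (s := -(1 / (x + 1)))
    (neg_le_neg ((div_le_one hx1).mpr (by linarith))) (sub_nonneg.mpr hp1)
    (by linarith : 1 - p ≤ 1)
  have hbase : 1 + -(1 / (x + 1)) = x / (x + 1) := by field_simp; ring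
  rw [hbase, Real.div_rpow hx hx1.le, div_le_iff₀ (Real.rpow_pos_of_pos hx1 _)] at hbern
  have hsplit : (x + 1) ^ (1 - p) = (x + 1) * (x + 1) ^ (-p) := by
    rw [sub_eq_add_neg, Real.rpow_add hx1, Real.rpow_one]
  have hexp : (1 + (1 - p) * -(1 / (x + 1))) * (x + 1) ^ (1 - p) =
      (x + 1) ^ (1 - p) - (1 - p) * (x + 1) ^ (-p) := by
    rw [hsplit]; field_simp; ring
  linarith

theorem Real.one_sub_mul_sum_range_rpow_neg_le {p c : ℝ} (hp0 : 0 ≤ p) (hp1 : p ≤ 1)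
    (hc : 0 ≤ c) (d : ℕ) :
    (1 - p) * ∑ j ∈ Finset.range d, ((j : ℝ) + 1 + c) ^ (-p) ≤
      ((d : ℝ) + c) ^ (1 - p) - c ^ (1 - p) := by
  induction d with
  | zero => simp
  | succ d ih =>
    have hstep := Real.one_sub_mul_rpow_neg_le_sub hp0 hp1 (by positivity : 0 ≤ (d : ℝ) + c)
    rw [Finset.sum_range_succ, mul_add]
    push_cast
    rw [add_right_comm (d : ℝ) 1 c]
    linarith


/-- Let `G` be an infinite, simple, locally finite, connected graph,
`e` an enumeration with nondecreasing degrees, `s, p ∈ (0,1)`, `λ > 0`, and `n` such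
that `deg (e k) ≥ (k+1)/s` for all `k ≥ n`.  Then for every vertex
`v ∉ K = ⋃_{k<n} B_1(e k)` one has
`Σ_{w∼v} (deg w + λ)^{−p} ≤ (s^p/(1−p)) · ((deg v + λ)^{1−p} − (sλ)^{1−p})`. -/
theorem neighbor_sum_rpow_estimate
    {V : Type*} (G : SimpleGraph V) [Infinite V]
    [∀ v : V, Fintype (G.neighborSet v)] (hconn : G.Connected)
    (e : ℕ → V) (he : Function.Bijective e)
    (hmono : ∀ k : ℕ, G.degree (e k) ≤ G.degree (e (k + 1)))
    (s p lam : ℝ) (hs0 : 0 < s) (hs1 : s < 1) (hp0 : 0 < p) (hp1 : p < 1)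
    (hlam : 0 < lam) (n : ℕ)
    (hdeg : ∀ k ≥ n, ((k : ℝ) + 1) / s ≤ (G.degree (e k) : ℝ))
    (v : V)
    (hv : v ∉ ⋃ k ∈ Finset.range n, (({e k} : Set V) ∪ G.neighborSet (e k))) :
    ∑ w ∈ G.neighborFinset v, ((G.degree w : ℝ) + lam) ^ (-p) ≤
      (s ^ p / (1 - p)) *
        (((G.degree v : ℝ) + lam) ^ (1 - p) - (s * lam) ^ (1 - p)) := by
  obtain ⟨idx, hleft, hright⟩ := Function.bijective_iff_has_inverse.mp he
  have hc : 0 < s * lam := mul_pos hs0 hlam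
  have hidx : ∀ w ∈ G.neighborFinset v, n ≤ idx w := by
    intro w hw
    by_contra! hlt
    refine hv (Set.mem_iUnion₂.mpr ⟨idx w, Finset.mem_range.mpr hlt, Or.inr ?_⟩)
    rw [hright w]
    exact ((G.mem_neighborFinset v w).mp hw).symm
  have hterm : ∀ w ∈ G.neighborFinset v, ((G.degree w : ℝ) + lam) ^ (-p) ≤
      s ^ p * ((idx w : ℝ) + 1 + s * lam) ^ (-p) := by
    intro w hw
    have hd := hdeg (idx w) (hidx w hw)
    rw [hright w] at hd
    have hscale : s ^ p * ((idx w : ℝ) + 1 + s * lam) ^ (-p) =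
        (((idx w : ℝ) + 1) / s + lam) ^ (-p) := by
      have hdiv : ((idx w : ℝ) + 1) / s + lam = ((idx w : ℝ) + 1 + s * lam) / s := by
        field_simp
      rw [hdiv, Real.div_rpow (by positivity) hs0.le, Real.rpow_neg hs0.le, div_inv_eq_mul,
        mul_comm]
    rw [hscale]
    exact Real.rpow_le_rpow_of_nonpos (by positivity) (by linarith) (by linarith)
  have hanti : Antitone fun j : ℕ => ((j : ℝ) + 1 + s * lam) ^ (-p) := fun i j hij =>
    Real.rpow_le_rpow_of_nonpos (by positivity) (by gcongr) (by linarith)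
  have hinj : Set.InjOn idx (G.neighborFinset v) := hright.injective.injOn
  have hsum : ∑ w ∈ G.neighborFinset v, ((idx w : ℝ) + 1 + s * lam) ^ (-p) ≤
      ∑ j ∈ Finset.range (G.degree v), ((j : ℝ) + 1 + s * lam) ^ (-p) := by
    have h := Finset.sum_le_sum_range_card_of_antitone hanti ((G.neighborFinset v).image idx)
    rwa [Finset.sum_image hinj, Finset.card_image_of_injOn hinj,
      G.card_neighborFinset_eq_degree] at h
  have hint := Real.one_sub_mul_sum_range_rpow_neg_le hp0.le hp1.le hc.le (G.degree v)
  have hlast : ((G.degree v : ℝ) + s * lam) ^ (1 - p) ≤ ((G.degree v : ℝ) + lam) ^ (1 - p) :=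
    Real.rpow_le_rpow (by positivity) (by nlinarith) (by linarith)
  have hp : 0 < 1 - p := by linarith
  calc _ ≤ ∑ w ∈ G.neighborFinset v, s ^ p * ((idx w : ℝ) + 1 + s * lam) ^ (-p) :=
        Finset.sum_le_sum hterm
    _ ≤ s ^ p * ((((G.degree v : ℝ) + lam) ^ (1 - p) - (s * lam) ^ (1 - p)) / (1 - p)) := by
        rw [← Finset.mul_sum]
        refine mul_le_mul_of_nonneg_left (hsum.trans ?_) (Real.rpow_nonneg hs0.le p)
        rw [le_div_iff₀' hp]
        linarith
    _ = _ := by ring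
end

section
/- For every real number s ∈ (0,1) there exists an infinite, simple, locally finite, connected graph G = (V,E) such that limsup_{k→∞} η(k)/k = s and the isoperimetric constant at infinity satisfies α_∞ = 1 − 2s/(1+s²). -/
open Finset

/-- If at most `r * d v` points `w` of `U` satisfy `d w ≤ d v`, then the sum of the excesses of `d`
over `a` is at least the integral of the excess of `x / r` over `a`. -/
theorem sq_posPart_le_sum_posPart {V : Type*} {r : ℝ} (hr : 0 < r) (d : V → ℝ) (a : ℝ)
    (U : Finset V) (h : ∀ v ∈ U, ((#{w ∈ U | d w ≤ d v} : ℕ) : ℝ) ≤ r * d v) :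
    r / 2 * (max (#U / r - a) 0) ^ 2 ≤ ∑ v ∈ U, max (d v - a) 0 +
      r / 2 * (max (-a) 0) ^ 2 := by
  classical
  induction hn : #U generalizing U with
  | zero =>
    obtain rfl := card_eq_zero.mp hn
    simp
  | succ n ih =>
    obtain ⟨v, hv, hmax⟩ := U.exists_max_image d (card_pos.mp (by omega))
    have hcard : #(U.erase v) = n := by rw [card_erase_of_mem hv, hn]; rfl
    have key := ih (U.erase v) (fun w hw => le_trans
      (by exact_mod_cast card_le_card (filter_subset_filter _ (erase_subset v U)))
      (h w (mem_of_mem_erase hw))) hcard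
    have hdv : ((n + 1 : ℕ) : ℝ) / r ≤ d v := by
      have := h v hv
      rw [filter_true_of_mem hmax, hn] at this
      rw [div_le_iff₀ hr]
      linarith
    rw [← add_sum_erase _ _ hv]
    have hmono : max (((n + 1 : ℕ) : ℝ) / r - a) 0 ≤ max (d v - a) 0 :=
      max_le_max_right _ (by linarith)
    suffices r / 2 * (max (((n + 1 : ℕ) : ℝ) / r - a) 0) ^ 2 ≤
        max (((n + 1 : ℕ) : ℝ) / r - a) 0 + r / 2 * (max ((n : ℝ) / r - a) 0) ^ 2 by
      linarith
    have hstep : ((n + 1 : ℕ) : ℝ) / r - a = n / r - a + 1 / r := by push_cast; ring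
    rw [hstep]
    generalize (n : ℝ) / r - a = x
    have hr1 : r * (1 / r) = 1 := by field_simp
    have hr2 : 0 < 1 / r := by positivity
    generalize 1 / r = q at *
    rcases le_total 0 x with hx | hx
    · rw [max_eq_left (by linarith), max_eq_left hx]
      nlinarith
    · rw [max_eq_right hx]
      rcases le_total 0 (x + q) with hy | hy
      · rw [max_eq_left hy]
        nlinarith [mul_nonneg hr.le hy]
      · rw [max_eq_right hy]
        simp

/-- The sum of the excesses of `i / s` over `a`, for `i < n`, is at most the integral of the excess of
`x / s` over `a`, which runs from `s * a` to `n` when `0 ≤ a`. -/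
theorem sum_range_posPart_le {s : ℝ} (hs : 0 < s) (a : ℝ) (n : ℕ) :
    ∑ i ∈ range n, max ((i : ℝ) / s - a) 0 ≤ s / 2 * (max (n / s - a) 0) ^ 2 := by
  induction n with
  | zero => simp; positivity
  | succ n ih =>
    rw [sum_range_succ]
    have hstep : ((n + 1 : ℕ) : ℝ) / s - a = n / s - a + 1 / s := by push_cast; ring
    rw [hstep]
    revert ih
    generalize (n : ℝ) / s - a = x
    intro ih
    have hs1 : s * (1 / s) = 1 := by field_simp
    have hs2 : 0 < 1 / s := by positivity
    generalize 1 / s = q at *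
    rcases le_total 0 x with hx | hx
    · rw [max_eq_left hx] at *
      rw [max_eq_left (by linarith)]
      nlinarith
    · rw [max_eq_right hx] at *
      have : 0 ≤ s / 2 * (max (x + q) 0) ^ 2 := by positivity
      simp only [ne_eq, OfNat.ofNat_ne_zero, not_false_eq_true, zero_pow, mul_zero] at ih
      linarith

namespace SimpleGraph

variable {V : Type*} (G : SimpleGraph V)

theorem ncard_boundary_eq_sum [DecidableEq V] (hG : ∀ v, (G.neighborSet v).Finite)
    (U : Finset V) :
    {p : V × V | p.1 ∈ U ∧ p.2 ∉ U ∧ G.Adj p.1 p.2}.ncard =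
      ∑ v ∈ U, #((hG v).toFinset \ U) := by
  rw [← card_sigma, ← card_map (Equiv.sigmaEquivProd V V).toEmbedding, ← Set.ncard_coe_finset]
  congr 1
  ext ⟨v, w⟩
  simp [and_comm]

/-- A finite set in which vertices of degree at most `t` number at most `r * t` satisfies the
isoperimetric inequality with constant `1 - 2 * r / (1 + r ^ 2)`. -/
theorem le_ncard_boundary_div_vol (hG : ∀ v, (G.neighborSet v).Finite) {r : ℝ}
    (hr0 : 0 < r) (hr1 : r < 1) {U : Finset V} (hU : U.Nonempty)
    (h : ∀ v ∈ U, ((#{w ∈ U | (G.neighborSet w).ncard ≤ (G.neighborSet v).ncard} : ℕ) : ℝ) ≤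
      r * (G.neighborSet v).ncard) :
    1 - 2 * r / (1 + r ^ 2) ≤
      ({p : V × V | p.1 ∈ U ∧ p.2 ∉ U ∧ G.Adj p.1 p.2}.ncard : ℝ) /
        ∑ v ∈ U, ((G.neighborSet v).ncard : ℝ) := by
  classical
  set d : V → ℝ := fun v => (G.neighborSet v).ncard
  set S := ∑ v ∈ U, max (d v - #U) 0 with hS
  have hn : (0 : ℝ) < #U := by exact_mod_cast hU.card_pos
  have hexc : (#U : ℝ) ^ 2 * ((1 - r) ^ 2 / (2 * r)) ≤ S := by
    have := sq_posPart_le_sum_posPart hr0 d #U U (by simpa [d] using h)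
    rw [max_eq_right (by linarith : -(#U : ℝ) ≤ 0), max_eq_left] at this
    · refine le_trans (le_of_eq ?_) (this.trans (by simp [hS]))
      field_simp
    · rw [sub_nonneg, le_div_iff₀ hr0]
      nlinarith
  have hbdry : S ≤ ({p : V × V | p.1 ∈ U ∧ p.2 ∉ U ∧ G.Adj p.1 p.2}.ncard : ℝ) := by
    rw [G.ncard_boundary_eq_sum hG U]
    push_cast
    refine sum_le_sum fun v _ => max_le ?_ (by positivity)
    have h1 : #(hG v).toFinset ≤ #((hG v).toFinset \ U) + #U := card_le_card_sdiff_add_card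
    rw [← Set.ncard_eq_toFinset_card _ (hG v)] at h1
    rw [sub_le_iff_le_add]
    change ((G.neighborSet v).ncard : ℝ) ≤ _
    exact_mod_cast h1
  have hvol : ∑ v ∈ U, d v ≤ (#U : ℝ) ^ 2 + S := by
    have : (#U : ℝ) ^ 2 = ∑ v ∈ U, (#U : ℝ) := by simp [sq]
    rw [this, hS, ← sum_add_distrib]
    exact sum_le_sum fun v _ => by linarith [le_max_left (d v - #U) 0]
  have hpos : 0 < ∑ v ∈ U, d v := by
    refine sum_pos (fun v hv => ?_) hU
    have h1 : 0 < #{w ∈ U | (G.neighborSet w).ncard ≤ (G.neighborSet v).ncard} :=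
      card_pos.mpr ⟨v, by simp [hv]⟩
    have h2 : (0 : ℝ) < #{w ∈ U | (G.neighborSet w).ncard ≤ (G.neighborSet v).ncard} := by
      exact_mod_cast h1
    exact pos_of_mul_pos_right (h2.trans_le (h v hv)) hr0.le
  rw [le_div_iff₀ hpos]
  have hc : 1 - 2 * r / (1 + r ^ 2) = (1 - r) ^ 2 / (1 + r ^ 2) := by field_simp; ring
  have hc0 : 0 ≤ (1 - r) ^ 2 / (1 + r ^ 2) := by positivity
  rw [hc]
  refine le_trans (mul_le_mul_of_nonneg_left hvol hc0) (le_trans ?_ hbdry)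
  rw [div_mul_eq_mul_div, div_le_iff₀ (by positivity)]
  have : (#U : ℝ) ^ 2 * (1 - r) ^ 2 ≤ S * (2 * r) := by
    rw [← div_le_iff₀ (by positivity), mul_div_assoc]
    exact hexc
  linarith

end SimpleGraph

/-- The disjoint cliques on `Fin (n k)`, where vertex `i` of the `k`-th clique is also joined to
the first `f k i` vertices of the next one. -/
def cliqueTower (n : ℕ → ℕ) (f : ℕ → ℕ → ℕ) : SimpleGraph (Σ k, Fin (n k)) where
  Adj p q := (p.1 = q.1 ∧ p ≠ q) ∨ (q.1 = p.1 + 1 ∧ (q.2 : ℕ) < f p.1 p.2) ∨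
    (p.1 = q.1 + 1 ∧ (p.2 : ℕ) < f q.1 q.2)
  symm := ⟨fun p q h => by
    rcases h with h | h | h
    · exact Or.inl ⟨h.1.symm, h.2.symm⟩
    · exact Or.inr (Or.inr h)
    · exact Or.inr (Or.inl h)⟩
  loopless := ⟨fun p h => by
    rcases h with h | h | h
    · exact h.2 rfl
    · omega
    · omega⟩

namespace cliqueTower

variable {n : ℕ → ℕ} {f : ℕ → ℕ → ℕ}

theorem adj_iff {p q : Σ k, Fin (n k)} : (cliqueTower n f).Adj p q ↔
    (p.1 = q.1 ∧ p ≠ q) ∨ (q.1 = p.1 + 1 ∧ (q.2 : ℕ) < f p.1 p.2) ∨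
      (p.1 = q.1 + 1 ∧ (p.2 : ℕ) < f q.1 q.2) :=
  Iff.rfl

open Classical in
theorem neighborSet_eq (p : Σ k, Fin (n k)) : (cliqueTower n f).neighborSet p =
    ((range (p.1 + 2)).sigma fun j =>
      univ.filter fun b : Fin (n j) => (cliqueTower n f).Adj p ⟨j, b⟩ :
      Finset (Σ k, Fin (n k))) := by
  ext ⟨j, b⟩
  simp only [SimpleGraph.mem_neighborSet, coe_sigma, Set.mem_sigma_iff, mem_coe, mem_range,
    mem_filter_univ, iff_and_self]
  rw [adj_iff]
  simp only
  omega

theorem finite_neighborSet (p : Σ k, Fin (n k)) : ((cliqueTower n f).neighborSet p).Finite := by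
  classical
  rw [neighborSet_eq]
  exact Finset.finite_toSet _

theorem ncard_neighborSet_bounds (p : Σ k, Fin (n k)) (hf : f p.1 p.2 ≤ n (p.1 + 1)) :
    n p.1 - 1 + f p.1 p.2 ≤ ((cliqueTower n f).neighborSet p).ncard ∧
      ((cliqueTower n f).neighborSet p).ncard ≤
        ∑ j ∈ range p.1, n j + (n p.1 - 1 + f p.1 p.2) := by
  classical
  obtain ⟨k, i⟩ := p
  rw [neighborSet_eq, Set.ncard_coe_finset, card_sigma, sum_range_succ, sum_range_succ]
  have hsame : #{b : Fin (n k) | (cliqueTower n f).Adj ⟨k, i⟩ ⟨k, b⟩} = n k - 1 := by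
    have : ({b : Fin (n k) | (cliqueTower n f).Adj ⟨k, i⟩ ⟨k, b⟩} : Finset _) = univ.erase i := by
      ext b
      simp [adj_iff, eq_comm]
    rw [this, card_erase_of_mem (mem_univ i), card_univ, Fintype.card_fin]
  have hnext : #{b : Fin (n (k + 1)) | (cliqueTower n f).Adj ⟨k, i⟩ ⟨k + 1, b⟩} = f k i := by
    have : ({b : Fin (n (k + 1)) | (cliqueTower n f).Adj ⟨k, i⟩ ⟨k + 1, b⟩} : Finset _) =
        ({b : Fin (n (k + 1)) | (b : ℕ) < f k i} : Finset _) := by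
      ext b
      simp [adj_iff]
      omega
    rw [this, Fin.card_filter_val_lt]
    exact min_eq_right hf
  have hprev : ∑ j ∈ range k, #{b : Fin (n j) | (cliqueTower n f).Adj ⟨k, i⟩ ⟨j, b⟩} ≤
      ∑ j ∈ range k, n j :=
    sum_le_sum fun j _ => (card_le_univ _).trans (by simp)
  simp only at *
  omega

theorem connected (hn : ∀ k, 0 < n k) (hf : ∀ k i, 0 < f k i) :
    (cliqueTower n f).Connected := by
  have key : ∀ k (i : Fin (n k)),
      (cliqueTower n f).Reachable ⟨k, i⟩ ⟨0, ⟨0, hn 0⟩⟩ := by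
    have hlevel : ∀ k (i j : Fin (n k)), (cliqueTower n f).Reachable ⟨k, i⟩ ⟨k, j⟩ := by
      intro k i j
      by_cases hij : i = j
      · rw [hij]
      · exact SimpleGraph.Adj.reachable (adj_iff.mpr (Or.inl ⟨rfl, by simpa using hij⟩))
    intro k
    induction k with
    | zero => exact fun i => hlevel 0 i _
    | succ k ih =>
      intro i
      refine (hlevel (k + 1) i ⟨0, hn _⟩).trans (SimpleGraph.Reachable.trans ?_ (ih ⟨0, hn k⟩))
      exact SimpleGraph.Adj.reachable (adj_iff.mpr (Or.inr (Or.inr ⟨rfl, hf _ _⟩)))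
  have : Nonempty (Σ k, Fin (n k)) := ⟨⟨0, ⟨0, hn 0⟩⟩⟩
  exact ⟨fun p q => (key p.1 p.2).trans (key q.1 q.2).symm⟩

/-- The vertices of the `k`-th clique. -/
def level (n : ℕ → ℕ) (k : ℕ) : Finset (Σ k, Fin (n k)) := ({k} : Finset ℕ).sigma fun _ => univ

theorem mem_level {k : ℕ} {p : Σ k, Fin (n k)} : p ∈ level n k ↔ p.1 = k := by
  simp [level]

theorem card_level (k : ℕ) : #(level n k) = n k := by
  simp [level]

theorem sum_level (k : ℕ) (F : (Σ k, Fin (n k)) → ℝ) :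
    ∑ p ∈ level n k, F p = ∑ i : Fin (n k), F ⟨k, i⟩ := by
  rw [level, sum_sigma, sum_singleton]

theorem ncard_boundary_level_le (k : ℕ) :
    ({p : (Σ k, Fin (n k)) × (Σ k, Fin (n k)) | p.1 ∈ level n k ∧ p.2 ∉ level n k ∧
      (cliqueTower n f).Adj p.1 p.2}.ncard : ℝ) ≤
      ∑ v ∈ level n k, (((cliqueTower n f).neighborSet v).ncard : ℝ) - n k * (n k - 1) := by
  classical
  rw [(cliqueTower n f).ncard_boundary_eq_sum finite_neighborSet]
  have : (n k : ℝ) * (n k - 1) = ∑ v ∈ level n k, ((n k : ℝ) - 1) := by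
    rw [sum_const, card_level, nsmul_eq_mul]
  push_cast
  rw [this, ← sum_sub_distrib]
  refine sum_le_sum fun v hv => ?_
  have hsub : (level n k).erase v ⊆
      ((finite_neighborSet (f := f) v).toFinset ∩ level n k) := by
    intro w hw
    rw [mem_erase] at hw
    rw [mem_inter, Set.Finite.mem_toFinset, SimpleGraph.mem_neighborSet, adj_iff]
    exact ⟨Or.inl ⟨(mem_level.mp hv).trans (mem_level.mp hw.2).symm, hw.1.symm⟩, hw.2⟩
  have h1 := card_le_card hsub
  rw [card_erase_of_mem hv, card_level] at h1
  have h2 := card_sdiff_add_card_inter (finite_neighborSet (f := f) v).toFinset (level n k)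
  rw [← Set.ncard_eq_toFinset_card _ (finite_neighborSet v)] at h2
  have h3 : #((finite_neighborSet (f := f) v).toFinset \ level n k) + n k ≤
      ((cliqueTower n f).neighborSet v).ncard + 1 := by omega
  have h4 : (#((finite_neighborSet (f := f) v).toFinset \ level n k) : ℝ) + n k ≤
      ((cliqueTower n f).neighborSet v).ncard + 1 := by exact_mod_cast h3
  linarith

/-- The number of forward edges that raises the degree of vertex `i` of the `k`-th clique to
`max ⌊i / s⌋ (n k)`, edges to the previous clique not counted. -/
noncomputable def excess (s : ℝ) (n : ℕ → ℕ) (k i : ℕ) : ℕ := ⌊(i : ℝ) / s⌋₊ - n k + 1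

section Excess

variable {s : ℝ}

theorem ncard_neighborSet_excess_bounds (hn : ∀ k, 0 < n k)
    (hf : ∀ k i, i < n k → excess s n k i ≤ n (k + 1)) (k : ℕ) (i : Fin (n k)) :
    max ⌊(i : ℝ) / s⌋₊ (n k) ≤ ((cliqueTower n (excess s n)).neighborSet ⟨k, i⟩).ncard ∧
      ((cliqueTower n (excess s n)).neighborSet ⟨k, i⟩).ncard ≤
        ∑ j ∈ range k, n j + max ⌊(i : ℝ) / s⌋₊ (n k) := by
  have h := ncard_neighborSet_bounds (f := excess s n) ⟨k, i⟩ (hf k i i.2)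
  have h1 := hn k
  simp only [excess] at h ⊢
  omega

theorem exists_finset_low_degree (hs0 : 0 < s) (hn : ∀ k, 0 < n k) (hmono : StrictMono n)
    (hf : ∀ k i, i < n k → excess s n k i ≤ n (k + 1))
    (hsum : Filter.Tendsto (fun k => (∑ j ∈ range k, (n j : ℝ)) / n k) Filter.atTop (nhds 0))
    {r : ℝ} (hr : s < r) :
    ∃ M : ℕ, ∀ m ≥ M, ∃ T : Finset (Σ k, Fin (n k)),
      {v | ((cliqueTower n (excess s n)).neighborSet v).ncard ≤ m} ⊆ (T : Set _) ∧
        (#T : ℝ) ≤ r * m := by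
  classical
  set ε := (r - s) / 2 with hε
  have hε0 : 0 < ε := by rw [hε]; linarith
  obtain ⟨k₀, hk₀⟩ := Filter.eventually_atTop.mp (hsum.eventually_le_const hε0)
  obtain ⟨M, hM⟩ := exists_nat_ge ((s + 1) / ε)
  refine ⟨max M (n k₀), fun m hm => ?_⟩
  have hm1 : M ≤ m := (le_max_left _ _).trans hm
  have hm2 : n k₀ ≤ m := (le_max_right _ _).trans hm
  have hex : ∃ k, m < n (k + 1) :=
    ⟨m, (Nat.lt_succ_self m).trans_le hmono.le_apply⟩
  set k := Nat.find hex with hk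
  have hlt : m < n (k + 1) := Nat.find_spec hex
  have hk0 : k₀ ≤ k := by
    have := hmono.lt_iff_lt.mp (hm2.trans_lt hlt)
    omega
  have hle : n k ≤ m := by
    rcases Nat.eq_zero_or_pos k with h0 | h0
    · have : k₀ = k := by omega
      rwa [← this]
    · have := Nat.find_min hex (m := k - 1) (by omega)
      rw [Nat.sub_add_cancel h0] at this
      omega
  refine ⟨(range k).sigma (fun _ => univ) ∪
    ({k} : Finset ℕ).sigma (fun j => {i : Fin (n j) | (i : ℕ) < ⌈s * (m + 1)⌉₊}), ?_, ?_⟩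
  · rintro ⟨j, i⟩ hv
    have hd := (ncard_neighborSet_excess_bounds hn hf j i).1
    have hd' := hd.trans hv
    have hj : j < k + 1 := hmono.lt_iff_lt.mp (((le_max_right _ _).trans hd').trans_lt hlt)
    rw [mem_coe, mem_union, mem_sigma, mem_sigma]
    by_cases hjk : j < k
    · exact Or.inl ⟨mem_range.mpr hjk, mem_univ _⟩
    · refine Or.inr ⟨mem_singleton.mpr (by simp only; omega), ?_⟩
      rw [mem_filter_univ, Nat.lt_ceil]
      have h1 : (⌊(i : ℝ) / s⌋₊ : ℝ) ≤ m := by exact_mod_cast (le_max_left _ _).trans hd'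
      have h2 := Nat.lt_floor_add_one ((i : ℝ) / s)
      have h3 : (i : ℝ) / s < m + 1 := by linarith
      rw [div_lt_iff₀ hs0] at h3
      linarith
  · refine (Nat.cast_le.mpr (card_union_le _ _)).trans ?_
    rw [card_sigma, card_sigma, sum_singleton, Fin.card_filter_val_lt]
    simp only [card_univ, Fintype.card_fin]
    have h1 : ((min (n k) ⌈s * (m + 1 : ℝ)⌉₊ : ℕ) : ℝ) ≤ s * (m + 1) + 1 :=
      (Nat.cast_le.mpr (min_le_right _ _)).trans (Nat.ceil_lt_add_one (by positivity)).le
    have h2 : (∑ j ∈ range k, (n j : ℝ)) ≤ ε * m := by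
      have := hk₀ k hk0
      rw [div_le_iff₀ (by exact_mod_cast hn k)] at this
      exact this.trans (mul_le_mul_of_nonneg_left (by exact_mod_cast hle) hε0.le)
    have h3 : s + 1 ≤ ε * m := by
      have : (s + 1) / ε ≤ m := hM.trans (by exact_mod_cast hm1)
      rw [div_le_iff₀ hε0] at this
      linarith
    have h4 : r = s + ε + ε := by rw [hε]; ring
    rw [h4, Nat.cast_add, Nat.cast_sum]
    linarith

theorem finite_low_degree (hs0 : 0 < s) (hn : ∀ k, 0 < n k) (hmono : StrictMono n)
    (hf : ∀ k i, i < n k → excess s n k i ≤ n (k + 1))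
    (hsum : Filter.Tendsto (fun k => (∑ j ∈ range k, (n j : ℝ)) / n k) Filter.atTop (nhds 0))
    (m : ℕ) : {v | ((cliqueTower n (excess s n)).neighborSet v).ncard ≤ m}.Finite := by
  obtain ⟨M, hM⟩ := exists_finset_low_degree hs0 hn hmono hf hsum (lt_add_one s)
  obtain ⟨T, hT, -⟩ := hM (max M m) (le_max_left _ _)
  exact T.finite_toSet.subset fun v hv => hT (le_trans hv (le_max_right M m))

theorem limsup_low_degree (hs0 : 0 < s) (hs1 : s < 1) (hn : ∀ k, 0 < n k) (hmono : StrictMono n)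
    (hf : ∀ k i, i < n k → excess s n k i ≤ n (k + 1))
    (hsum : Filter.Tendsto (fun k => (∑ j ∈ range k, (n j : ℝ)) / n k) Filter.atTop (nhds 0)) :
    Filter.limsup (fun m : ℕ =>
      ({v | ((cliqueTower n (excess s n)).neighborSet v).ncard ≤ m}.ncard : ℝ) / m)
      Filter.atTop = s := by
  classical
  have hupper : ∀ r, s < r → ∀ᶠ m : ℕ in Filter.atTop,
      ({v | ((cliqueTower n (excess s n)).neighborSet v).ncard ≤ m}.ncard : ℝ) / m ≤ r := by
    intro r hr
    obtain ⟨M, hM⟩ := exists_finset_low_degree hs0 hn hmono hf hsum hr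
    filter_upwards [Filter.eventually_ge_atTop M] with m hm
    obtain ⟨T, hT, hc⟩ := hM m hm
    refine div_le_of_le_mul₀ (by positivity) (by linarith) (le_trans ?_ hc)
    rw [← Set.ncard_coe_finset]
    exact_mod_cast Set.ncard_le_ncard hT T.finite_toSet
  have hbdd : Filter.IsBoundedUnder (· ≤ ·) Filter.atTop (fun m : ℕ =>
      ({v | ((cliqueTower n (excess s n)).neighborSet v).ncard ≤ m}.ncard : ℝ) / m) :=
    ⟨s + 1, by simpa using hupper (s + 1) (by linarith)⟩
  refine le_antisymm (le_of_forall_gt_imp_ge_of_dense fun r hr => ?_)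
    (le_of_forall_lt_imp_le_of_dense fun r hr => ?_)
  · refine Filter.limsup_le_of_le ⟨0, fun a ha => ?_⟩ (hupper r hr)
    obtain ⟨m, hm⟩ := (Filter.eventually_map.mp ha).exists
    exact le_trans (by positivity) hm
  · refine Filter.le_limsup_of_frequently_le ?_ hbdd
    rw [Filter.frequently_atTop]
    intro M
    obtain ⟨k, hk, hkM⟩ := ((hsum.eventually_le_const (sub_pos.mpr hr)).and
      (Filter.eventually_ge_atTop M)).exists
    have hnk : (0 : ℝ) < n k := by exact_mod_cast hn k
    refine ⟨n k + ∑ j ∈ range k, n j, hkM.trans (hmono.le_apply.trans (Nat.le_add_right _ _)), ?_⟩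
    rw [div_le_iff₀ hnk] at hk
    have hS0 : (0 : ℝ) ≤ ∑ j ∈ range k, (n j : ℝ) := by positivity
    have hcount : s * n k ≤ ({v | ((cliqueTower n (excess s n)).neighborSet v).ncard ≤
        n k + ∑ j ∈ range k, n j}.ncard : ℝ) := by
      have hsub : ((({k} : Finset ℕ).sigma fun j =>
          ({i : Fin (n j) | (i : ℕ) < ⌈s * n k⌉₊} : Finset _) : Finset (Σ k, Fin (n k))) :
          Set (Σ k, Fin (n k))) ⊆ {v | ((cliqueTower n (excess s n)).neighborSet v).ncard ≤
        n k + ∑ j ∈ range k, n j} := by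
        rintro ⟨j, i⟩ hv
        rw [mem_coe, mem_sigma, mem_singleton, mem_filter_univ, Nat.lt_ceil] at hv
        obtain ⟨hj, hi⟩ := hv
        simp only at hj hi
        subst hj
        have hfl : ⌊(i : ℝ) / s⌋₊ ≤ n j := by
          refine Nat.floor_le_of_le ?_
          rw [div_le_iff₀ hs0]
          linarith
        have hd := (ncard_neighborSet_excess_bounds hn hf j i).2
        rw [max_eq_right hfl] at hd
        rw [Set.mem_ofPred_eq]
        omega
      have hc := Set.ncard_le_ncard hsub (finite_low_degree hs0 hn hmono hf hsum _)
      rw [Set.ncard_coe_finset, card_sigma, sum_singleton, Fin.card_filter_val_lt,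
        min_eq_right (Nat.ceil_le.mpr (by nlinarith))] at hc
      exact (Nat.le_ceil _).trans (by exact_mod_cast hc)
    push_cast
    rw [le_div_iff₀ (by linarith)]
    refine le_trans ?_ (by exact_mod_cast hcount)
    nlinarith

theorem vol_level_le (hs0 : 0 < s) (hs1 : s < 1) (hn : ∀ k, 0 < n k)
    (hf : ∀ k i, i < n k → excess s n k i ≤ n (k + 1)) (k : ℕ) :
    ∑ v ∈ level n k, (((cliqueTower n (excess s n)).neighborSet v).ncard : ℝ) ≤
      (n k : ℝ) ^ 2 * ((1 + s ^ 2) / (2 * s) + (∑ j ∈ range k, (n j : ℝ)) / n k) := by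
  have hnk : (0 : ℝ) < n k := by exact_mod_cast hn k
  rw [sum_level]
  have h1 : ∀ i : Fin (n k), (((cliqueTower n (excess s n)).neighborSet ⟨k, i⟩).ncard : ℝ) ≤
      (∑ j ∈ range k, (n j : ℝ)) + n k + max ((i : ℝ) / s - n k) 0 := by
    intro i
    refine (Nat.cast_le.mpr (ncard_neighborSet_excess_bounds hn hf k i).2).trans ?_
    push_cast
    have := Nat.floor_le (a := (i : ℝ) / s) (by positivity)
    have h2 : max (⌊(i : ℝ) / s⌋₊ : ℝ) (n k) ≤ n k + max ((i : ℝ) / s - n k) 0 :=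
      max_le (by linarith [le_max_left ((i : ℝ) / s - n k) 0])
        (by linarith [le_max_right ((i : ℝ) / s - n k) 0])
    linarith
  refine (sum_le_sum fun i _ => h1 i).trans ?_
  rw [sum_add_distrib, Fin.sum_univ_eq_sum_range (fun i : ℕ => max ((i : ℝ) / s - n k) 0) (n k)]
  have h2 := sum_range_posPart_le hs0 (n k) (n k)
  rw [max_eq_left (by rw [sub_nonneg, le_div_iff₀ hs0]; nlinarith)] at h2
  rw [sum_const, card_univ, Fintype.card_fin, nsmul_eq_mul]
  have h3 : (n k : ℝ) ^ 2 * ((1 + s ^ 2) / (2 * s) + (∑ j ∈ range k, (n j : ℝ)) / n k) =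
      n k * ((∑ j ∈ range k, (n j : ℝ)) + n k) + s / 2 * (n k / s - n k) ^ 2 := by
    field_simp
    ring
  rw [h3]
  linarith

theorem ratio_level_le (hs0 : 0 < s) (hs1 : s < 1) (hn : ∀ k, 0 < n k)
    (hf : ∀ k i, i < n k → excess s n k i ≤ n (k + 1)) (k : ℕ) :
    ({p : (Σ k, Fin (n k)) × (Σ k, Fin (n k)) | p.1 ∈ level n k ∧ p.2 ∉ level n k ∧
      (cliqueTower n (excess s n)).Adj p.1 p.2}.ncard : ℝ) /
        ∑ v ∈ level n k, (((cliqueTower n (excess s n)).neighborSet v).ncard : ℝ) ≤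
      1 - (1 - 1 / n k) / ((1 + s ^ 2) / (2 * s) + (∑ j ∈ range k, (n j : ℝ)) / n k) := by
  have hnk : (0 : ℝ) < n k := by exact_mod_cast hn k
  have hnk1 : (1 : ℝ) ≤ n k := by exact_mod_cast hn k
  have hb := ncard_boundary_level_le (n := n) (f := excess s n) k
  have hv := vol_level_le hs0 hs1 hn hf k
  have hpos : 0 < ∑ v ∈ level n k,
      (((cliqueTower n (excess s n)).neighborSet v).ncard : ℝ) := by
    rw [sum_level]
    refine sum_pos (fun i _ => ?_) ⟨⟨0, hn k⟩, mem_univ _⟩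
    exact_mod_cast (hn k).trans_le
      ((le_max_right _ _).trans (ncard_neighborSet_excess_bounds hn hf k i).1)
  have hc : 0 < (1 + s ^ 2) / (2 * s) + (∑ j ∈ range k, (n j : ℝ)) / n k := by positivity
  generalize ∑ v ∈ level n k,
    (((cliqueTower n (excess s n)).neighborSet v).ncard : ℝ) = W at *
  generalize (1 + s ^ 2) / (2 * s) + (∑ j ∈ range k, (n j : ℝ)) / n k = c at *
  rw [div_le_iff₀ hpos]
  refine hb.trans ?_
  have h1 : (1 - 1 / (n k : ℝ)) / c * W ≤ n k * (n k - 1) := by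
    have h0 : 0 ≤ (1 - 1 / (n k : ℝ)) / c :=
      div_nonneg (sub_nonneg.mpr ((div_le_one hnk).mpr hnk1)) hc.le
    refine (mul_le_mul_of_nonneg_left hv h0).trans (le_of_eq ?_)
    field_simp
  linarith

theorem isoperimetric_at_infinity (hs0 : 0 < s) (hs1 : s < 1) (hn : ∀ k, 0 < n k)
    (hmono : StrictMono n) (hf : ∀ k i, i < n k → excess s n k i ≤ n (k + 1))
    (hsum : Filter.Tendsto (fun k => (∑ j ∈ range k, (n j : ℝ)) / n k) Filter.atTop (nhds 0)) :
    IsLUB {x : ℝ | ∃ K : Finset (Σ k, Fin (n k)),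
      x = sInf {y : ℝ | ∃ U : Finset (Σ k, Fin (n k)), U.Nonempty ∧ (∀ u ∈ U, u ∉ K) ∧
        y = ({p : (Σ k, Fin (n k)) × (Σ k, Fin (n k)) | p.1 ∈ U ∧ p.2 ∉ U ∧
          (cliqueTower n (excess s n)).Adj p.1 p.2}.ncard : ℝ) /
            ∑ v ∈ U, (((cliqueTower n (excess s n)).neighborSet v).ncard : ℝ)}}
      (1 - 2 * s / (1 + s ^ 2)) := by
  classical
  have hlevel : ∀ K : Finset (Σ k, Fin (n k)), ∀ᶠ k in Filter.atTop, ∀ u ∈ level n k, u ∉ K := by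
    intro K
    filter_upwards [Filter.eventually_gt_atTop (K.sup Sigma.fst)] with k hk u hu huK
    have := le_sup (f := Sigma.fst) huK
    rw [mem_level.mp hu] at this
    omega
  have hne : ∀ k, (level n k).Nonempty := fun k => card_pos.mp (by rw [card_level]; exact hn k)
  constructor
  · rintro _ ⟨K, rfl⟩
    have hlim : Filter.Tendsto (fun k => 1 - (1 - 1 / (n k : ℝ)) /
        ((1 + s ^ 2) / (2 * s) + (∑ j ∈ range k, (n j : ℝ)) / n k)) Filter.atTop
        (nhds (1 - 2 * s / (1 + s ^ 2))) := by
      have h1 : Filter.Tendsto (fun k => 1 / (n k : ℝ)) Filter.atTop (nhds 0) :=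
        tendsto_one_div_atTop_nhds_zero_nat.comp hmono.tendsto_atTop
      have h2 := (h1.const_sub 1).div (hsum.const_add ((1 + s ^ 2) / (2 * s)))
        (by rw [add_zero]; positivity)
      have h3 : 2 * s / (1 + s ^ 2) = (1 - 0) / ((1 + s ^ 2) / (2 * s) + 0) := by
        rw [sub_zero, add_zero, one_div_div]
      rw [h3]
      exact h2.const_sub 1
    refine ge_of_tendsto hlim ?_
    filter_upwards [hlevel K] with k hk
    refine le_trans (csInf_le ⟨0, ?_⟩ ?_) (ratio_level_le hs0 hs1 hn hf k)
    swap
    · exact ⟨level n k, hne k, hk, rfl⟩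
    rintro _ ⟨U, -, -, rfl⟩
    positivity
  · intro b hb
    have hr : ∀ r ∈ Set.Ioo s 1, 1 - 2 * r / (1 + r ^ 2) ≤ b := by
      rintro r ⟨hsr, hr1⟩
      have hr0 := hs0.trans hsr
      obtain ⟨M, hM⟩ := exists_finset_low_degree hs0 hn hmono hf hsum hsr
      refine le_trans ?_
        (mem_upperBounds.mp hb _ ⟨(finite_low_degree hs0 hn hmono hf hsum M).toFinset, rfl⟩)
      obtain ⟨k, hk⟩ := (hlevel (finite_low_degree hs0 hn hmono hf hsum M).toFinset).exists
      refine le_csInf ⟨_, level n k, hne k, hk, rfl⟩ ?_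
      rintro _ ⟨U, hU, hUK, rfl⟩
      refine SimpleGraph.le_ncard_boundary_div_vol _ finite_neighborSet hr0 hr1 hU fun v hv => ?_
      have hvM : M ≤ ((cliqueTower n (excess s n)).neighborSet v).ncard := by
        have := hUK v hv
        rw [Set.Finite.mem_toFinset, Set.mem_ofPred_eq, not_le] at this
        exact this.le
      obtain ⟨T, hT, hc⟩ := hM _ hvM
      refine le_trans (Nat.cast_le.mpr (card_le_card fun w hw => ?_)) hc
      exact hT (mem_filter.mp hw).2
    have hcont : Continuous fun r : ℝ => 1 - 2 * r / (1 + r ^ 2) := by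
      refine continuous_const.sub (Continuous.div (by fun_prop) (by fun_prop) fun r => ?_)
      positivity
    refine le_of_tendsto (hcont.continuousWithinAt (s := Set.Ioi s) (x := s)) ?_
    filter_upwards [Ioo_mem_nhdsGT hs1] with r hr'
    exact hr r hr'

end Excess

theorem sum_factorial_mul_le {A : ℕ} (hA : 2 ≤ A) (k : ℕ) :
    (∑ j ∈ range k, (j + A).factorial) * (k + A) ≤ 2 * (k + A).factorial := by
  induction k with
  | zero => simp
  | succ k ih =>
    have h1 : (k + 1 + A).factorial = (k + A + 1) * (k + A).factorial := by
      rw [← Nat.factorial_succ]; congr 1; omega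
    have h2 : ∑ j ∈ range k, (j + A).factorial ≤ (k + A).factorial := by nlinarith
    rw [sum_range_succ, h1]
    nlinarith

theorem tendsto_sum_factorial_div {A : ℕ} (hA : 2 ≤ A) :
    Filter.Tendsto (fun k : ℕ => (∑ j ∈ range k, ((j + A).factorial : ℝ)) / (k + A).factorial)
      Filter.atTop (nhds 0) := by
  refine squeeze_zero (fun k => by positivity) (g := fun k : ℕ => 2 / (k : ℝ)) (fun k => ?_)
    (tendsto_const_div_atTop_nhds_zero_nat 2)
  rcases Nat.eq_zero_or_pos k with rfl | hk
  · simp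
  have hk' : (0 : ℝ) < k := by exact_mod_cast hk
  rw [div_le_div_iff₀ (by positivity) hk']
  have h : (∑ j ∈ range k, (j + A).factorial) * k ≤ 2 * (k + A).factorial :=
    (Nat.mul_le_mul_left _ (Nat.le_add_right k A)).trans (sum_factorial_mul_le hA k)
  exact_mod_cast h

theorem excess_factorial_le {s : ℝ} {A : ℕ} (hA : 1 / s ≤ A) (k i : ℕ)
    (hi : i < (k + A).factorial) :
    excess s (fun k => (k + A).factorial) k i ≤ (k + 1 + A).factorial := by
  have h1 : (k + 1 + A).factorial = (k + A + 1) * (k + A).factorial := by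
    rw [← Nat.factorial_succ]; congr 1; omega
  have h2 : ⌊(i : ℝ) / s⌋₊ ≤ A * (k + A).factorial := by
    refine Nat.floor_le_of_le ?_
    push_cast
    rw [div_eq_mul_one_div, mul_comm]
    exact mul_le_mul hA (by exact_mod_cast hi.le) (by positivity) (by positivity)
  have h3 := Nat.factorial_pos (k + A)
  have h4 : ⌊(i : ℝ) / s⌋₊ - (k + A).factorial + 1 ≤ ⌊(i : ℝ) / s⌋₊ + 1 := by omega
  rw [h1]
  refine h4.trans ?_
  nlinarith

end cliqueTower


/-- For every `s ∈ (0,1)` there is an infinite, simple, locally finite,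
connected graph with `limsup_k η(k)/k = s` whose isoperimetric constant at infinity
`α_∞ = sup_K inf_{U ⊆ V∖K} #∂U / vol(U)` equals `1 − 2s/(1+s²)`. -/
theorem sharpness_of_isoperimetric_bound (s : ℝ) (hs0 : 0 < s) (hs1 : s < 1) :
    ∃ (V : Type) (G : SimpleGraph V), Infinite V ∧
      (∀ v : V, (G.neighborSet v).Finite) ∧ G.Connected ∧
      Filter.limsup
        (fun k : ℕ => ({v : V | (G.neighborSet v).ncard ≤ k}.ncard : ℝ) / k)
        Filter.atTop = s ∧
      sSup {x : ℝ | ∃ K : Finset V,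
          x = sInf {y : ℝ | ∃ U : Finset V, U.Nonempty ∧ (∀ u ∈ U, u ∉ K) ∧
            y = ({p : V × V | p.1 ∈ U ∧ p.2 ∉ U ∧ G.Adj p.1 p.2}.ncard : ℝ) /
                  ∑ v ∈ U, ((G.neighborSet v).ncard : ℝ)}} =
        1 - 2 * s / (1 + s ^ 2) := by
  obtain ⟨B, hB⟩ := exists_nat_ge (1 / s)
  have hA1 : 1 / s ≤ (B + 2 : ℕ) := by push_cast; linarith
  have hA2 : 2 ≤ B + 2 := Nat.le_add_left 2 B
  set n : ℕ → ℕ := fun k => (k + (B + 2)).factorial with hdef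
  have hn : ∀ k, 0 < n k := fun k => Nat.factorial_pos _
  have hmono : StrictMono n := fun a b hab =>
    (Nat.factorial_lt (by omega)).mpr (by omega)
  have hf : ∀ k i, i < n k → cliqueTower.excess s n k i ≤ n (k + 1) :=
    cliqueTower.excess_factorial_le hA1
  have hsum := cliqueTower.tendsto_sum_factorial_div hA2
  refine ⟨Σ k, Fin (n k), cliqueTower n (cliqueTower.excess s n), ?_,
    cliqueTower.finite_neighborSet, cliqueTower.connected hn fun k i => Nat.succ_pos _,
    cliqueTower.limsup_low_degree hs0 hs1 hn hmono hf hsum, ?_⟩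
  · exact Infinite.of_injective (fun k => (⟨k, ⟨0, hn k⟩⟩ : Σ k, Fin (n k)))
      fun a b hab => congrArg Sigma.fst hab
  · exact (cliqueTower.isoperimetric_at_infinity hs0 hs1 hn hmono hf hsum).csSup_eq ⟨_, ∅, rfl⟩
end

section
/- For every integer σ ≥ 2 there exists an infinite, simple, locally finite, connected graph G = (V,E) such that {v ∈ V : deg(v) ≤ k} is finite for every k (i.e. d_∞ = ∞) and limsup_{k→∞} η(k)/k ≤ 1/(σ − 1). -/
/-- The antitree with `s n` vertices in the `n`-th sphere: distinct vertices are adjacent exactly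
when their spheres coincide or are consecutive. -/
def antitree (s : ℕ → ℕ) : SimpleGraph (Σ n, Fin (s n)) where
  Adj v w := v ≠ w ∧ v.1 ≤ w.1 + 1 ∧ w.1 ≤ v.1 + 1
  symm := ⟨fun _ _ h => ⟨h.1.symm, h.2.2, h.2.1⟩⟩
  loopless := ⟨fun _ h => h.1 rfl⟩

namespace antitree

/-- The vertices in the first `m` spheres. -/
def firstSpheres (s : ℕ → ℕ) (m : ℕ) : Finset (Σ n, Fin (s n)) :=
  (Finset.range m).sigma fun _ => Finset.univ

theorem mem_firstSpheres {s : ℕ → ℕ} {m : ℕ} {v : Σ n, Fin (s n)} :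
    v ∈ firstSpheres s m ↔ v.1 < m := by
  simp [firstSpheres]

theorem card_firstSpheres (s : ℕ → ℕ) (m : ℕ) :
    (firstSpheres s m).card = ∑ n ∈ Finset.range m, s n := by
  simp [firstSpheres]

theorem finite_neighborSet (s : ℕ → ℕ) (v : Σ n, Fin (s n)) :
    ((antitree s).neighborSet v).Finite :=
  (firstSpheres s (v.1 + 2)).finite_toSet.subset fun _ hw =>
    Finset.mem_coe.2 (mem_firstSpheres.2 (Nat.lt_succ_of_le hw.2.2))

theorem connected {s : ℕ → ℕ} (hs : ∀ n, 0 < s n) : (antitree s).Connected := by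
  have step (n : ℕ) (v : Fin (s n)) : (antitree s).Reachable ⟨0, ⟨0, hs 0⟩⟩ ⟨n, v⟩ := by
    induction n with
    | zero =>
      by_cases h : (⟨0, ⟨0, hs 0⟩⟩ : Σ n, Fin (s n)) = ⟨0, v⟩
      · rw [h]
      · exact SimpleGraph.Adj.reachable ⟨h, by simp, by simp⟩
    | succ n ih =>
      refine (ih ⟨0, hs n⟩).trans (SimpleGraph.Adj.reachable ⟨fun h => ?_, ?_, ?_⟩)
      · exact absurd (congrArg Sigma.fst h) (Nat.succ_ne_self n).symm
      · exact Nat.le_succ_of_le (Nat.le_succ n)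
      · exact le_rfl
  exact SimpleGraph.connected_iff_exists_forall_reachable _ |>.2
    ⟨⟨0, ⟨0, hs 0⟩⟩, fun v => step v.1 v.2⟩

theorem infinite {s : ℕ → ℕ} (hs : ∀ n, 0 < s n) : Infinite (Σ n, Fin (s n)) :=
  Infinite.of_injective (fun n => (⟨n, ⟨0, hs n⟩⟩ : Σ n, Fin (s n)))
    fun _ _ h => congrArg Sigma.fst h

/-- Every vertex is adjacent to the whole next sphere. -/
theorem le_ncard_neighborSet (s : ℕ → ℕ) (v : Σ n, Fin (s n)) :
    s (v.1 + 1) ≤ ((antitree s).neighborSet v).ncard := by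
  let f : Fin (s (v.1 + 1)) → Σ n, Fin (s n) := fun i => ⟨v.1 + 1, i⟩
  have hf : Function.Injective f := fun i j h => eq_of_heq (Sigma.mk.inj h).2
  calc s (v.1 + 1) = (Set.range f).ncard := by
        rw [← Set.image_univ, Set.ncard_image_of_injective _ hf, Set.ncard_univ, Nat.card_fin]
    _ ≤ _ := by
        refine Set.ncard_le_ncard ?_ (finite_neighborSet s v)
        rintro _ ⟨i, rfl⟩
        refine ⟨fun h => ?_, ?_, ?_⟩
        · exact absurd (congrArg Sigma.fst h) (Nat.succ_ne_self v.1).symm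
        · exact Nat.le_succ_of_le (Nat.le_succ v.1)
        · exact le_rfl

theorem sublevel_subset_firstSpheres {σ : ℕ} (hσ : 2 ≤ σ) (k : ℕ) :
    {v | ((antitree fun n => σ ^ n).neighborSet v).ncard ≤ k} ⊆
      (firstSpheres (fun n => σ ^ n) (Nat.log σ k) : Set (Σ n, Fin (σ ^ n))) := fun v hv =>
  Finset.mem_coe.2 <| mem_firstSpheres.2 <|
    Nat.le_log_of_pow_le hσ ((le_ncard_neighborSet (fun n => σ ^ n) v).trans hv)

theorem ncard_sublevel_div_le {σ : ℕ} (hσ : 2 ≤ σ) (k : ℕ) :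
    ({v | ((antitree fun n => σ ^ n).neighborSet v).ncard ≤ k}.ncard : ℝ) / k ≤
      1 / ((σ : ℝ) - 1) := by
  have hσ' : (0 : ℝ) < σ - 1 := by
    have : (2 : ℝ) ≤ σ := by exact_mod_cast hσ
    linarith
  rcases Nat.eq_zero_or_pos k with rfl | hk
  · simpa using hσ'.le
  have hcard : {v | ((antitree fun n => σ ^ n).neighborSet v).ncard ≤ k}.ncard ≤
      ∑ n ∈ Finset.range (Nat.log σ k), σ ^ n := by
    rw [← card_firstSpheres, ← Set.ncard_coe_finset]
    exact Set.ncard_le_ncard (sublevel_subset_firstSpheres hσ k) (Finset.finite_toSet _)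
  have hpow : (σ : ℝ) ^ Nat.log σ k ≤ k := by exact_mod_cast Nat.pow_log_le_self σ hk.ne'
  rw [div_le_div_iff₀ (by exact_mod_cast hk) hσ', one_mul]
  calc _ ≤ (∑ n ∈ Finset.range (Nat.log σ k), (σ : ℝ) ^ n) * (σ - 1) := by
        gcongr
        exact_mod_cast hcard
    _ = (σ : ℝ) ^ Nat.log σ k - 1 := geom_sum_mul _ _
    _ ≤ k := by linarith

end antitree

/-- For every integer `σ ≥ 2` there is an infinite, simple, locally
finite, connected graph with `d_∞ = ∞` (all degree sublevel sets finite) and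
`limsup_k η(k)/k ≤ 1/(σ − 1)` (realized by the antitree with sphere sizes `σⁿ`). -/
theorem antitree_small_r_infinity (σ : ℕ) (hσ : 2 ≤ σ) :
    ∃ (V : Type) (G : SimpleGraph V), Infinite V ∧
      (∀ v : V, (G.neighborSet v).Finite) ∧ G.Connected ∧
      (∀ k : ℕ, {v : V | (G.neighborSet v).ncard ≤ k}.Finite) ∧
      Filter.limsup
        (fun k : ℕ => ({v : V | (G.neighborSet v).ncard ≤ k}.ncard : ℝ) / k)
        Filter.atTop ≤ 1 / ((σ : ℝ) - 1) := by
  have hs (n : ℕ) : 0 < σ ^ n := pow_pos (by lia) n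
  refine ⟨Σ n, Fin (σ ^ n), antitree fun n => σ ^ n, antitree.infinite hs,
    antitree.finite_neighborSet _, antitree.connected hs,
    fun k => (Finset.finite_toSet _).subset (antitree.sublevel_subset_firstSpheres hσ k), ?_⟩
  refine Filter.limsup_le_of_le ?_ (Filter.Eventually.of_forall (antitree.ncard_sublevel_div_le hσ))
  exact Filter.isCoboundedUnder_le_of_le _ (x := 0) fun k => by positivity
end
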